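/- If a, b, and c are all odd natural numbers, then Player 1 has a winning strategy in the (a,b,c)-game; that is, the state with a ones, b twos, and c threes is a first-player win in the reversed Zeckendorf game. -/

import Mathlib

/-- The Fibonacci numbers indexed so that `zfib 1 = 1`, `zfib 2 = 2`,
and `zfib (i+1) = zfib i + zfib (i-1)`. -/
def zfib (i : ℕ) : ℕ := Nat.fib (i + 1)

/-- A game state: a finitely supported function recording the height of each bin.
Bin indices start at `1`; index `0` is unused. -/
abbrev ZState := ℕ →₀ ℕ

/-- The legal moves of the reversed Zeckendorf game. -/
inductive ZMove : ZState → ZState → Prop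
  | split (h : ZState) (i : ℕ) (hi : 2 ≤ i) (hpos : 0 < h (i + 1)) :
      ZMove h (h - Finsupp.single (i + 1) 1 + Finsupp.single i 1 + Finsupp.single (i - 1) 1)
  | splitTwo (h : ZState) (hpos : 0 < h 2) :
      ZMove h (h - Finsupp.single 2 1 + Finsupp.single 1 2)
  | combine (h : ZState) (i : ℕ) (hi : 2 < i) (h1 : 0 < h (i + 1)) (h2 : 0 < h (i - 2)) :
      ZMove h (h - Finsupp.single (i + 1) 1 - Finsupp.single (i - 2) 1 + Finsupp.single i 2)
  | combineTwo (h : ZState) (h1 : 0 < h 3) (h2 : 0 < h 1) :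
      ZMove h (h - Finsupp.single 3 1 - Finsupp.single 1 1 + Finsupp.single 2 2)

mutual
  /-- The state is a first-player win: some legal move leads to a state that is a
  loss for the player then to move. -/
  inductive ZFirstWin : ZState → Prop
    | intro (h h' : ZState) (m : ZMove h h') (hl : ZLoss h') : ZFirstWin h
  /-- The state is a loss for the player to move (i.e., not a first-player win):
  every legal move leads to a first-player win for the opponent. -/
  inductive ZLoss : ZState → Prop
    | intro (h : ZState) (hall : ∀ h', ZMove h h' → ZFirstWin h') : ZLoss h
end

/-- The starting state of the `(a,b,c)`-game: `a` ones, `b` twos and `c` threes. -/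
noncomputable def abcState (a b c : ℕ) : ZState :=
  Finsupp.single 1 a + Finsupp.single 2 b + Finsupp.single 3 c

lemma abc_apply (a b c n : ℕ) : abcState a b c n =
    (if n = 1 then a else 0) + (if n = 2 then b else 0) + (if n = 3 then c else 0) := by
  simp [abcState, Finsupp.single_apply, eq_comm]

lemma abc_high (a b c n : ℕ) (h : 0 < abcState a b c (n + 1)) : n ≤ 2 := by
  rw [abc_apply] at h
  by_contra hn
  rw [if_neg (by omega), if_neg (by omega), if_neg (by omega)] at h
  omega

lemma abc_eqS (a b c : ℕ) (hc : 0 < c) : abcState a b c - Finsupp.single (2 + 1) 1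
    + Finsupp.single 2 1 + Finsupp.single (2 - 1) 1 = abcState (a + 1) (b + 1) (c - 1) := by
  ext n
  simp only [Finsupp.add_apply, Finsupp.tsub_apply, abc_apply, Finsupp.single_apply]
  split_ifs <;> omega

lemma abc_eqT (a b c : ℕ) (hb : 0 < b) : abcState a b c - Finsupp.single 2 1
    + Finsupp.single 1 2 = abcState (a + 2) (b - 1) c := by
  ext n
  simp only [Finsupp.add_apply, Finsupp.tsub_apply, abc_apply, Finsupp.single_apply]
  split_ifs <;> omega

lemma abc_eqC (a b c : ℕ) (hc : 0 < c) (ha : 0 < a) : abcState a b c - Finsupp.single 3 1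
    - Finsupp.single 1 1 + Finsupp.single 2 2 = abcState (a - 1) (b + 2) (c - 1) := by
  ext n
  simp only [Finsupp.add_apply, Finsupp.tsub_apply, abc_apply, Finsupp.single_apply]
  split_ifs <;> omega

lemma abc_moveS (a b c : ℕ) (hc : 0 < c) :
    ZMove (abcState a b c) (abcState (a + 1) (b + 1) (c - 1)) := by
  rw [← abc_eqS a b c hc]
  exact ZMove.split _ 2 le_rfl (by simpa [abc_apply] using hc)

lemma abc_moveT (a b c : ℕ) (hb : 0 < b) :
    ZMove (abcState a b c) (abcState (a + 2) (b - 1) c) := by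
  rw [← abc_eqT a b c hb]
  exact ZMove.splitTwo _ (by simpa [abc_apply] using hb)

lemma abc_moveC (a b c : ℕ) (hc : 0 < c) (ha : 0 < a) :
    ZMove (abcState a b c) (abcState (a - 1) (b + 2) (c - 1)) := by
  rw [← abc_eqC a b c hc ha]
  exact ZMove.combineTwo _ (by simpa [abc_apply] using hc) (by simpa [abc_apply] using ha)

lemma abc_cases (a b c : ℕ) (h' : ZState) (m : ZMove (abcState a b c) h') :
    (0 < c ∧ h' = abcState (a + 1) (b + 1) (c - 1)) ∨
    (0 < b ∧ h' = abcState (a + 2) (b - 1) c) ∨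
    (0 < c ∧ 0 < a ∧ h' = abcState (a - 1) (b + 2) (c - 1)) := by
  cases m with
  | split i hi hpos =>
    obtain rfl : i = 2 := le_antisymm (abc_high _ _ _ _ hpos) hi
    have hc : 0 < c := by simpa [abc_apply] using hpos
    exact Or.inl ⟨hc, abc_eqS a b c hc⟩
  | splitTwo hpos =>
    have hb : 0 < b := by simpa [abc_apply] using hpos
    exact Or.inr (Or.inl ⟨hb, abc_eqT a b c hb⟩)
  | combine i hi h1 h2 =>
    have := abc_high _ _ _ _ h1
    omega
  | combineTwo h1 h2 =>
    have hc : 0 < c := by simpa [abc_apply] using h1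
    have ha : 0 < a := by simpa [abc_apply] using h2
    exact Or.inr (Or.inr ⟨hc, ha, abc_eqC a b c hc ha⟩)

/-- The losing positions `(a, b, c)`. -/
def AbcP (a b c : ℕ) : Prop :=
  b % 2 = 0 ∧ ((a % 2 = 0 ∧ (c % 2 = 0 ∨ a < c)) ∨ (c % 2 = 0 ∧ c < a))

lemma abc_exists (a b c : ℕ) (h : ¬ AbcP a b c) :
    (0 < c ∧ AbcP (a + 1) (b + 1) (c - 1)) ∨ (0 < b ∧ AbcP (a + 2) (b - 1) c) ∨
    (0 < c ∧ 0 < a ∧ AbcP (a - 1) (b + 2) (c - 1)) := by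
  unfold AbcP at *
  omega

lemma abc_main (n : ℕ) : ∀ a b c : ℕ, a + 3 * b + 6 * c = n →
    (AbcP a b c → ZLoss (abcState a b c)) ∧ (¬ AbcP a b c → ZFirstWin (abcState a b c)) := by
  induction n using Nat.strong_induction_on with
  | _ n ih =>
    intro a b c hn
    constructor
    · intro hP
      refine ZLoss.intro _ fun h' m => ?_
      rcases abc_cases a b c h' m with ⟨hc, rfl⟩ | ⟨hb, rfl⟩ | ⟨hc, ha, rfl⟩
      · exact (ih _ (by omega) _ _ _ rfl).2 (by unfold AbcP at *; omega)
      · exact (ih _ (by omega) _ _ _ rfl).2 (by unfold AbcP at *; omega)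
      · exact (ih _ (by omega) _ _ _ rfl).2 (by unfold AbcP at *; omega)
    · intro hN
      rcases abc_exists a b c hN with ⟨hc, h⟩ | ⟨hb, h⟩ | ⟨hc, ha, h⟩
      · exact ZFirstWin.intro _ _ (abc_moveS a b c hc) ((ih _ (by omega) _ _ _ rfl).1 h)
      · exact ZFirstWin.intro _ _ (abc_moveT a b c hb) ((ih _ (by omega) _ _ _ rfl).1 h)
      · exact ZFirstWin.intro _ _ (abc_moveC a b c hc ha) ((ih _ (by omega) _ _ _ rfl).1 h)

theorem abcGame_odd_odd_odd_firstPlayerWin (a b c : ℕ) (ha : Odd a) (hb : Odd b) (hc : Odd c) :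
    ZFirstWin (abcState a b c) := by
  refine (abc_main _ a b c rfl).2 fun h => ?_
  have h1 := h.1
  rw [Nat.odd_iff] at hb
  omega
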